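/- Let K be a field of characteristic zero and let F be a five-dimensional invariant subspace of K[Σ₃] not containing V = Id − τ₁₂ − τ₁₃ − τ₂₃ + c₁ + c₂. Then F = { (a₁,a₂,a₃,a₄,a₅,a₆) ∈ K[Σ₃] : a₁ − a₂ − a₃ − a₄ + a₅ + a₆ = 0 }, and F = F_v for v = (2,1,1,1,1,0) = 2·Id + τ₁₂ + τ₁₃ + τ₂₃ + c₁. -/

import Mathlib

open scoped TensorProduct

abbrev S3 := Equiv.Perm (Fin 3)

def t12 : S3 := Equiv.swap 0 1
def t13 : S3 := Equiv.swap 0 2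
def t23 : S3 := Equiv.swap 1 2
def c1 : S3 := Equiv.swap 0 2 * Equiv.swap 0 1
def c2 : S3 := c1 * c1

abbrev GA (K : Type*) [Field K] := S3 → K

def act {K : Type*} [Field K] (σ : S3) (v : GA K) : GA K := fun τ => v (σ * τ)

def Fv (K : Type*) [Field K] (v : GA K) : Submodule K (GA K) :=
  Submodule.span K (Set.range fun σ => act σ v)

def elt {K : Type*} [Field K] (a₁ a₂ a₃ a₄ a₅ a₆ : K) : GA K := fun σ =>
  (if σ = 1 then a₁ else 0) + (if σ = t12 then a₂ else 0) + (if σ = t13 then a₃ else 0) +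
  (if σ = t23 then a₄ else 0) + (if σ = c1 then a₅ else 0) + (if σ = c2 then a₆ else 0)

def Vv (K : Type*) [Field K] : GA K := elt 1 (-1) (-1) (-1) 1 1
def Wv (K : Type*) [Field K] : GA K := elt 1 1 1 1 1 1

def assoc {K A : Type*} [Field K] [AddCommGroup A] [Module K A]
    (μ : A →ₗ[K] A →ₗ[K] A) (x y z : A) : A := μ (μ x y) z - μ x (μ y z)

def bra {K A : Type*} [Field K] [AddCommGroup A] [Module K A]
    (μ : A →ₗ[K] A →ₗ[K] A) (x y : A) : A := μ x y - μ y x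

def LieAdmissible {K A : Type*} [Field K] [AddCommGroup A] [Module K A]
    (μ : A →ₗ[K] A →ₗ[K] A) : Prop :=
  ∀ x y z : A, bra μ x (bra μ y z) + bra μ y (bra μ z x) + bra μ z (bra μ x y) = 0

def Lterm {K A : Type*} [Field K] [AddCommGroup A] [Module K A]
    (μ : A →ₗ[K] A →ₗ[K] A) (σ : S3) (x : Fin 3 → A) : A :=
  μ (μ (x (σ⁻¹ 0)) (x (σ⁻¹ 1))) (x (σ⁻¹ 2))

def Rterm {K A : Type*} [Field K] [AddCommGroup A] [Module K A]
    (μ : A →ₗ[K] A →ₗ[K] A) (σ : S3) (x : Fin 3 → A) : A :=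
  μ (x (σ⁻¹ 0)) (μ (x (σ⁻¹ 1)) (x (σ⁻¹ 2)))

def assocPhi {K A : Type*} [Field K] [AddCommGroup A] [Module K A]
    (μ : A →ₗ[K] A →ₗ[K] A) (v : GA K) : Prop :=
  ∀ x : Fin 3 → A, ∑ σ : S3, v σ • assoc μ (x (σ⁻¹ 0)) (x (σ⁻¹ 1)) (x (σ⁻¹ 2)) = 0

theorem S3.sum_eq {M : Type*} [AddCommMonoid M] (f : S3 → M) :
    ∑ σ : S3, f σ = f 1 + f t12 + f t13 + f t23 + f c1 + f c2 := by
  have h : (Finset.univ : Finset S3) = {1, t12, t13, t23, c1, c2} := by decide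
  rw [h, Finset.sum_insert (by decide), Finset.sum_insert (by decide),
    Finset.sum_insert (by decide), Finset.sum_insert (by decide),
    Finset.sum_insert (by decide), Finset.sum_singleton]
  simp only [add_assoc]

theorem S3.cases (σ : S3) :
    σ = 1 ∨ σ = t12 ∨ σ = t13 ∨ σ = t23 ∨ σ = c1 ∨ σ = c2 := by
  revert σ
  decide

theorem elt_values {K : Type*} [Field K] (a₁ a₂ a₃ a₄ a₅ a₆ : K) :
    elt a₁ a₂ a₃ a₄ a₅ a₆ 1 = a₁ ∧ elt a₁ a₂ a₃ a₄ a₅ a₆ t12 = a₂ ∧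
    elt a₁ a₂ a₃ a₄ a₅ a₆ t13 = a₃ ∧ elt a₁ a₂ a₃ a₄ a₅ a₆ t23 = a₄ ∧
    elt a₁ a₂ a₃ a₄ a₅ a₆ c1 = a₅ ∧ elt a₁ a₂ a₃ a₄ a₅ a₆ c2 = a₆ := by
  simp +decide [elt]

theorem Vv_apply (K : Type*) [Field K] (σ : S3) :
    Vv K σ = ((Equiv.Perm.sign σ : ℤ) : K) := by
  obtain ⟨h1, h2, h3, h4, h5, h6⟩ := elt_values (1 : K) (-1) (-1) (-1) 1 1
  have s2 : Equiv.Perm.sign t12 = -1 := by decide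
  have s3 : Equiv.Perm.sign t13 = -1 := by decide
  have s4 : Equiv.Perm.sign t23 = -1 := by decide
  have s5 : Equiv.Perm.sign c1 = 1 := by decide
  have s6 : Equiv.Perm.sign c2 = 1 := by decide
  rcases S3.cases σ with rfl | rfl | rfl | rfl | rfl | rfl <;>
    simp [Vv, *]

/-- The linear functional `x ↦ ∑ σ, sign σ * x σ` on the group algebra. -/
def signFunctional (K : Type*) [Field K] : GA K →ₗ[K] K :=
  ∑ σ : S3, Vv K σ • LinearMap.proj σ

theorem signFunctional_apply {K : Type*} [Field K] (x : GA K) :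
    signFunctional K x = ∑ σ : S3, Vv K σ * x σ := by
  simp [signFunctional]

theorem signFunctional_eq {K : Type*} [Field K] (x : GA K) :
    signFunctional K x = x 1 - x t12 - x t13 - x t23 + x c1 + x c2 := by
  obtain ⟨h1, h2, h3, h4, h5, h6⟩ := elt_values (1 : K) (-1) (-1) (-1) 1 1
  rw [signFunctional_apply, S3.sum_eq, Vv, h1, h2, h3, h4, h5, h6]
  ring

theorem sum_sign_smul_act {K : Type*} [Field K] (x : GA K) :
    ∑ σ : S3, Vv K σ • act σ x = signFunctional K x • Vv K := by
  ext τ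
  simp only [Finset.sum_apply, Pi.smul_apply, smul_eq_mul, act, signFunctional_apply,
    Finset.sum_mul]
  refine Fintype.sum_equiv (Equiv.mulRight τ) _ _ fun σ => ?_
  have h : ((Equiv.Perm.sign τ : ℤ) : K) * ((Equiv.Perm.sign τ : ℤ) : K) = 1 := by
    rw [← Int.cast_mul, Int.units_coe_mul_self, Int.cast_one]
  simp only [Vv_apply, Equiv.coe_mulRight, Equiv.Perm.sign_mul, Units.val_mul, Int.cast_mul]
  linear_combination (-((Equiv.Perm.sign σ : ℤ) : K) * x (σ * τ)) * h

theorem finrank_ker_signFunctional_le (K : Type*) [Field K] :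
    Module.finrank K (LinearMap.ker (signFunctional K)) ≤ 5 := by
  have hne : LinearMap.ker (signFunctional K) ≠ ⊤ := by
    intro h
    have h0 : signFunctional K (elt 1 0 0 0 0 0) = 0 := by
      rw [← LinearMap.mem_ker, h]
      exact Submodule.mem_top
    obtain ⟨h1, h2, h3, h4, h5, h6⟩ := elt_values (1 : K) 0 0 0 0 0
    simp [signFunctional_eq, h1, h2, h3, h4, h5, h6] at h0
  have hlt := Submodule.finrank_lt hne
  rw [Module.finrank_fintype_fun_eq_card, show Fintype.card S3 = 6 by decide] at hlt
  omega

theorem eq_sum_act_of_signFunctional_eq_zero {K : Type*} [Field K] [CharZero K] {x : GA K}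
    (hx : signFunctional K x = 0) :
    x = ∑ σ : S3, ((x σ⁻¹ - x (σ⁻¹ * c2)) / 3 + (∑ τ : S3, x τ) / 36) •
      act σ (elt 2 1 1 1 1 0) := by
  rw [signFunctional_eq] at hx
  have mul_c2 : t12 * c2 = t13 ∧ t13 * c2 = t23 ∧ t23 * c2 = t12 ∧ c1 * c2 = 1 ∧
      c2 * c2 = c1 := by decide
  have inv_eq : t12⁻¹ = t12 ∧ t13⁻¹ = t13 ∧ t23⁻¹ = t23 ∧ c1⁻¹ = c2 ∧ c2⁻¹ = c1 := by decide
  ext τ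
  rcases S3.cases τ with rfl | rfl | rfl | rfl | rfl | rfl <;>
    simp +decide only [S3.sum_eq, Pi.add_apply, Pi.smul_apply, smul_eq_mul, act, elt,
      mul_c2, inv_eq, inv_one, one_mul, if_true, if_false]
  · linear_combination (1 / 6 : K) * hx
  · linear_combination (-1 / 6 : K) * hx
  · linear_combination (-1 / 6 : K) * hx
  · linear_combination (-1 / 6 : K) * hx
  · linear_combination (1 / 6 : K) * hx
  · linear_combination (1 / 6 : K) * hx

theorem stmt13 (K : Type*) [Field K] [CharZero K] (F : Submodule K (GA K))
    (hinv : ∀ (σ : S3) (x : GA K), x ∈ F → act σ x ∈ F)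
    (hdim : Module.finrank K F = 5) (hV : Vv K ∉ F) :
    (∀ x : GA K, x ∈ F ↔ x 1 - x t12 - x t13 - x t23 + x c1 + x c2 = 0)
    ∧ F = Fv K (elt 2 1 1 1 1 0) := by
  have hle : F ≤ LinearMap.ker (signFunctional K) := by
    intro x hx
    by_contra hne
    have hmem : signFunctional K x • Vv K ∈ F := by
      rw [← sum_sign_smul_act]
      exact F.sum_mem fun σ _ => F.smul_mem _ (hinv σ x hx)
    exact hV ((F.smul_mem_iff hne).mp hmem)
  have hF : F = LinearMap.ker (signFunctional K) :=
    Submodule.eq_of_le_of_finrank_le hle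
      (hdim ▸ finrank_ker_signFunctional_le K)
  have hmem (x : GA K) : x ∈ F ↔ x 1 - x t12 - x t13 - x t23 + x c1 + x c2 = 0 := by
    rw [hF, LinearMap.mem_ker, signFunctional_eq]
  refine ⟨hmem, le_antisymm (fun x hx => ?_) (Submodule.span_le.mpr ?_)⟩
  · rw [eq_sum_act_of_signFunctional_eq_zero (LinearMap.mem_ker.mp (hle hx))]
    exact Submodule.sum_mem _ fun σ _ =>
      Submodule.smul_mem _ _ (Submodule.subset_span ⟨σ, rfl⟩)
  · rintro _ ⟨σ, rfl⟩
    refine hinv σ _ ((hmem _).mpr ?_)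
    obtain ⟨h1, h2, h3, h4, h5, h6⟩ := elt_values (2 : K) 1 1 1 1 0
    rw [h1, h2, h3, h4, h5, h6]
    norm_num
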